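/- arXiv:1706.03180 — 2 statements merged into one kernel-verified Lean document; each statement's English description precedes it below -/
import Mathlib

section
/- Let n ∈ ℕ with n ≥ 2. The monoid B_n = ⟨a, b | ba = b^n⟩ is half-factorial if and only if n = 2. -/
/-- An atom (irreducible element) of a monoid: a non-unit `u` such that
`u = b * c` implies that `b` or `c` is a unit. -/
def IsMonAtom {M : Type*} [Monoid M] (u : M) : Prop :=
  ¬ IsUnit u ∧ ∀ b c : M, u = b * c → IsUnit b ∨ IsUnit c

/-- A monoid is reduced if its only invertible element is `1`. -/
def MonReduced (M : Type*) [Monoid M] : Prop := ∀ u : M, IsUnit u → u = 1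

/-- A monoid is (left and right) unit-cancellative if `a = a * u` or `a = u * a`
implies that `u` is a unit. -/
def UnitCancellative (M : Type*) [Monoid M] : Prop :=
  (∀ a u : M, a * u = a → IsUnit u) ∧ (∀ a u : M, u * a = a → IsUnit u)

/-- A monoid is atomic if every non-unit is a finite product of atoms. -/
def MonAtomic (M : Type*) [Monoid M] : Prop :=
  ∀ a : M, ¬ IsUnit a → ∃ l : List M, (∀ u ∈ l, IsMonAtom u) ∧ l.prod = a

attribute [local instance] Classical.propDecidable

/-- The set of lengths `L(a)` of an element: the set of all `k ∈ ℕ` such that `a`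
is a product of `k` atoms, with the convention `L(1) = {0}`. -/
noncomputable def setOfLengths {M : Type*} [Monoid M] (x : M) : Set ℕ :=
  if x = 1 then {0}
  else {k | ∃ l : List M, l.length = k ∧ (∀ u ∈ l, IsMonAtom u) ∧ l.prod = x}

/-- The system of sets of lengths `𝓛(M) = {L(a) : a ∈ M}`. -/
def LSystem (M : Type*) [Monoid M] : Set (Set ℕ) :=
  Set.range (setOfLengths (M := M))

/-- `U_k(M)`, the union of all sets of lengths containing `k`. -/
def unionOfLengths (M : Type*) [Monoid M] (k : ℕ) : Set ℕ :=
  ⋃₀ {L | L ∈ LSystem M ∧ k ∈ L}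
/-- The defining relation `b * a = b ^ n` of the monoid `B_n`, on the free
monoid over two generators (`0` stands for `a`, `1` stands for `b`). -/
def BnRel (n : ℕ) : FreeMonoid (Fin 2) → FreeMonoid (Fin 2) → Prop := fun x y =>
  x = FreeMonoid.of 1 * FreeMonoid.of 0 ∧ y = FreeMonoid.of 1 ^ n

/-- The congruence on the free monoid generated by the relation `b * a = b ^ n`. -/
def BnCon (n : ℕ) : Con (FreeMonoid (Fin 2)) := conGen (BnRel n)

/-- The monoid `B_n = ⟨ a, b ∣ b * a = b ^ n ⟩`. -/
abbrev Bn (n : ℕ) := (BnCon n).Quotient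

/-- The generator `a` of `B_n`. -/
def bA (n : ℕ) : Bn n := (BnCon n).mk' (FreeMonoid.of 0)

/-- The generator `b` of `B_n`. -/
def bB (n : ℕ) : Bn n := (BnCon n).mk' (FreeMonoid.of 1)

/-- A monoid is half-factorial if every set of lengths is a singleton. -/
def HalfFactorial (M : Type*) [Monoid M] : Prop :=
  ∀ a : M, ∃ k : ℕ, setOfLengths a = {k}

/-- The weight homomorphism on `B_n`, with `a ↦ n - 1` and `b ↦ 1`. -/
def bnWeight (n : ℕ) (hn : 2 ≤ n) : Bn n →* Multiplicative ℕ :=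
  (BnCon n).lift (FreeMonoid.lift ![Multiplicative.ofAdd (n - 1), Multiplicative.ofAdd 1]) <| by
    refine Con.conGen_le.2 ?_
    rintro x y ⟨rfl, rfl⟩
    simp only [Con.ker_rel, map_mul, map_pow, FreeMonoid.lift_eval_of, Matrix.cons_val_zero,
      Matrix.cons_val_one]
    rw [← ofAdd_add, ← ofAdd_nsmul]
    congr 1
    simp only [smul_eq_mul]
    omega

/-- The homomorphism on `B_n` with `a ↦ 1` and `b ↦ 0`. -/
def bnAvoid (n : ℕ) (hn : 2 ≤ n) : Bn n →* ℕ :=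
  (BnCon n).lift (FreeMonoid.lift ![1, 0]) <| by
    refine Con.conGen_le.2 ?_
    rintro x y ⟨rfl, rfl⟩
    simp [Con.ker_rel, show n ≠ 0 by omega]

lemma bnWeight_bA (n : ℕ) (hn : 2 ≤ n) : (bnWeight n hn (bA n)).toAdd = n - 1 := rfl

lemma bnWeight_bB (n : ℕ) (hn : 2 ≤ n) : (bnWeight n hn (bB n)).toAdd = 1 := rfl

lemma bnAvoid_bA (n : ℕ) (hn : 2 ≤ n) : bnAvoid n hn (bA n) = 1 := rfl

lemma bnAvoid_bB (n : ℕ) (hn : 2 ≤ n) : bnAvoid n hn (bB n) = 0 := rfl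

lemma bB_mul_bA (n : ℕ) : bB n * bA n = bB n ^ n :=
  (BnCon n).eq.2 (ConGen.Rel.of _ _ ⟨rfl, rfl⟩)

lemma Bn.induction {n : ℕ} {p : Bn n → Prop} (one : p 1)
    (bA_mul : ∀ x, p x → p (bA n * x)) (bB_mul : ∀ x, p x → p (bB n * x)) (x : Bn n) : p x := by
  induction x using Con.induction_on with
  | H w =>
    induction w using FreeMonoid.inductionOn' with
    | one => exact one
    | of_mul i w ih =>
      fin_cases i
      · exact bA_mul _ ih
      · exact bB_mul _ ih

lemma Bn.eq_one_or_weight_pos {n : ℕ} (hn : 2 ≤ n) (x : Bn n) :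
    x = 1 ∨ 1 ≤ (bnWeight n hn x).toAdd := by
  induction x using Bn.induction with
  | one => exact .inl rfl
  | bA_mul x _ => right; rw [map_mul, toAdd_mul, bnWeight_bA]; omega
  | bB_mul x _ => right; rw [map_mul, toAdd_mul, bnWeight_bB]; omega

lemma Bn.eq_one_or_avoid_eq_zero_or_le_weight {n : ℕ} (hn : 2 ≤ n) (x : Bn n) :
    x = 1 ∨ bnAvoid n hn x = 0 ∨ n - 1 ≤ (bnWeight n hn x).toAdd := by
  induction x using Bn.induction with
  | one => exact .inl rfl
  | bA_mul x _ => right; right; rw [map_mul, toAdd_mul, bnWeight_bA]; omega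
  | bB_mul x _ => right; left; rw [map_mul, bnAvoid_bB, zero_mul]

lemma Bn.isUnit_iff {n : ℕ} (hn : 2 ≤ n) {x : Bn n} : IsUnit x ↔ x = 1 := by
  refine ⟨fun h => ?_, fun h => h ▸ isUnit_one⟩
  obtain ⟨y, hy⟩ := h.exists_right_inv
  have hw := congrArg (fun z => (bnWeight n hn z).toAdd) hy
  simp only [map_mul, toAdd_mul, map_one, toAdd_one] at hw
  exact (Bn.eq_one_or_weight_pos hn x).resolve_right (by omega)

lemma isMonAtom_bA {n : ℕ} (hn : 2 ≤ n) : IsMonAtom (bA n) := by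
  refine ⟨fun h => ?_, fun x y hxy => ?_⟩
  · have hw := bnWeight_bA n hn
    rw [(Bn.isUnit_iff hn).1 h, map_one, toAdd_one] at hw
    omega
  · have hw := bnWeight_bA n hn
    have hv := bnAvoid_bA n hn
    rw [hxy, map_mul, toAdd_mul] at hw
    rw [hxy, map_mul] at hv
    rw [Bn.isUnit_iff hn, Bn.isUnit_iff hn]
    rcases Bn.eq_one_or_avoid_eq_zero_or_le_weight hn x with hx | hx | hx
    · exact .inl hx
    · simp [hx] at hv
    rcases Bn.eq_one_or_avoid_eq_zero_or_le_weight hn y with hy | hy | hy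
    · exact .inr hy
    · simp [hy] at hv
    omega

lemma isMonAtom_bB {n : ℕ} (hn : 2 ≤ n) : IsMonAtom (bB n) := by
  refine ⟨fun h => ?_, fun x y hxy => ?_⟩
  · have hw := bnWeight_bB n hn
    rw [(Bn.isUnit_iff hn).1 h, map_one, toAdd_one] at hw
    omega
  · have hw := bnWeight_bB n hn
    rw [hxy, map_mul, toAdd_mul] at hw
    rw [Bn.isUnit_iff hn, Bn.isUnit_iff hn]
    rcases Bn.eq_one_or_weight_pos hn x with hx | hx
    · exact .inl hx
    rcases Bn.eq_one_or_weight_pos hn y with hy | hy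
    · exact .inr hy
    omega

lemma IsMonAtom.eq_bA_or_eq_bB {n : ℕ} (hn : 2 ≤ n) {x : Bn n} (hx : IsMonAtom x) :
    x = bA n ∨ x = bB n := by
  induction x using Bn.induction with
  | one => exact absurd isUnit_one hx.1
  | bA_mul x _ =>
    have h := (hx.2 _ _ rfl).resolve_left (isMonAtom_bA hn).1
    left; rw [(Bn.isUnit_iff hn).1 h, mul_one]
  | bB_mul x _ =>
    have h := (hx.2 _ _ rfl).resolve_left (isMonAtom_bB hn).1
    right; rw [(Bn.isUnit_iff hn).1 h, mul_one]

lemma Bn.exists_atoms_prod_eq {n : ℕ} (hn : 2 ≤ n) (x : Bn n) :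
    ∃ l : List (Bn n), (∀ u ∈ l, IsMonAtom u) ∧ l.prod = x := by
  induction x using Bn.induction with
  | one => exact ⟨[], by simp, rfl⟩
  | bA_mul x ih =>
    obtain ⟨l, hl, rfl⟩ := ih
    exact ⟨bA n :: l, List.forall_mem_cons.2 ⟨isMonAtom_bA hn, hl⟩, List.prod_cons⟩
  | bB_mul x ih =>
    obtain ⟨l, hl, rfl⟩ := ih
    exact ⟨bB n :: l, List.forall_mem_cons.2 ⟨isMonAtom_bB hn, hl⟩, List.prod_cons⟩

lemma Bn.weight_prod_atoms_two {l : List (Bn 2)} (hl : ∀ u ∈ l, IsMonAtom u) :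
    (bnWeight 2 le_rfl l.prod).toAdd = l.length := by
  induction l with
  | nil => simp
  | cons u l ih =>
    obtain ⟨hu, hl⟩ := List.forall_mem_cons.1 hl
    have hw : (bnWeight 2 le_rfl u).toAdd = 1 := by
      rcases hu.eq_bA_or_eq_bB le_rfl with rfl | rfl <;> rfl
    rw [List.prod_cons, map_mul, toAdd_mul, ih hl, hw, List.length_cons, add_comm]

lemma halfFactorial_Bn_two : HalfFactorial (Bn 2) := by
  intro x
  by_cases hx : x = 1
  · exact ⟨0, by simp [setOfLengths, hx]⟩
  refine ⟨(bnWeight 2 le_rfl x).toAdd, ?_⟩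
  rw [setOfLengths, if_neg hx, Set.eq_singleton_iff_nonempty_unique_mem]
  constructor
  · obtain ⟨l, hl, h⟩ := Bn.exists_atoms_prod_eq le_rfl x
    exact ⟨_, l, rfl, hl, h⟩
  · rintro k ⟨l, rfl, hl, rfl⟩
    exact (Bn.weight_prod_atoms_two hl).symm

/-- For `n ≥ 2`, the monoid `B_n = ⟨a, b ∣ ba = b^n⟩` is
half-factorial if and only if `n = 2`. -/
theorem statement2 (n : ℕ) (hn : 2 ≤ n) :
    HalfFactorial (Bn n) ↔ n = 2 := by
  refine ⟨fun h => ?_, fun h => h ▸ halfFactorial_Bn_two⟩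
  obtain ⟨k, hk⟩ := h (bB n * bA n)
  have hne : bB n * bA n ≠ 1 := fun h1 => by
    have hw := congrArg (fun z => (bnWeight n hn z).toAdd) h1
    simp only [map_mul, toAdd_mul, map_one, toAdd_one, bnWeight_bB] at hw
    omega
  rw [setOfLengths, if_neg hne] at hk
  have h2 : 2 ∈ ({k} : Set ℕ) :=
    hk ▸ ⟨[bB n, bA n], rfl, by simp [isMonAtom_bA hn, isMonAtom_bB hn], by simp⟩
  have hn' : n ∈ ({k} : Set ℕ) :=
    hk ▸ ⟨List.replicate n (bB n), List.length_replicate,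
      fun u hu => List.eq_of_mem_replicate hu ▸ isMonAtom_bB hn,
      by rw [List.prod_replicate, bB_mul_bA]⟩
  exact hn'.trans h2.symm
end

section
/- Let n ∈ ℕ with n ≥ 3 and let ℓ ∈ ℕ with ℓ ≥ 2. Then the union of sets of lengths of B_n = ⟨a, b | ba = b^n⟩ containing ℓ satisfies U_ℓ(B_n) = ℓ − q_{ℓ,n}(n−2) + (n−2)·[0, q_{ℓ,n} + ℓ − 1]. -/
attribute [local instance] Classical.propDecidable

/-- The quantity `q_{m,n}`. -/
def qOf (m n : ℕ) : ℕ :=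
  if m = 0 then 0 else if (n - 1) ∣ m then m / (n - 1) - 1 else m / (n - 1)

/-- The arithmetical progression `x + d·[0,q] = {x + d*j : 0 ≤ j ≤ q}`. -/
def apSet (x d q : ℕ) : Set ℕ := {y | ∃ j : ℕ, j ≤ q ∧ y = x + d * j}

/-- The left action of the generators of `B_n` on normal forms: `(i, j)` stands for `a ^ i * b ^ j`. -/
def normalFormStep (n : ℕ) : Fin 2 → Function.End (ℕ × ℕ)
  | 0 => fun p => (p.1 + 1, p.2)
  | 1 => fun p => (0, 1 + p.1 * (n - 1) + p.2)

/-- The action of words on normal forms. -/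
def wordAction (n : ℕ) : FreeMonoid (Fin 2) →* Function.End (ℕ × ℕ) :=
  FreeMonoid.lift (normalFormStep n)

/-- The normal form `(i, j)` of a word equal to `a ^ i * b ^ j` in `B_n`. -/
def wordNormalForm (n : ℕ) (w : FreeMonoid (Fin 2)) : ℕ × ℕ := wordAction n w (0, 0)

lemma normalFormStep_one_pow (n k : ℕ) (p : ℕ × ℕ) :
    (normalFormStep n 1 ^ (k + 1)) p = (0, k + 1 + p.1 * (n - 1) + p.2) := by
  induction k with
  | zero => rw [zero_add, pow_one]; rfl
  | succ k ih =>
    rw [pow_succ']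
    change normalFormStep n 1 ((normalFormStep n 1 ^ (k + 1)) p) = _
    rw [ih]
    simp only [normalFormStep, Prod.mk.injEq, true_and]
    ring

lemma wordNormalForm_eq_of_mk'_eq {n : ℕ} (hn : 1 ≤ n) {v w : FreeMonoid (Fin 2)}
    (h : (BnCon n).mk' v = (BnCon n).mk' w) : wordNormalForm n v = wordNormalForm n w := by
  have hle : BnCon n ≤ Con.ker (wordAction n) := by
    refine Con.conGen_le.2 ?_
    rintro x y ⟨rfl, rfl⟩
    change wordAction n _ = wordAction n _
    rw [map_mul (wordAction n), map_pow, wordAction, FreeMonoid.lift_eval_of,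
      FreeMonoid.lift_eval_of]
    obtain ⟨k, rfl⟩ : ∃ k, n = k + 1 := ⟨n - 1, by omega⟩
    funext p
    rw [normalFormStep_one_pow]
    change normalFormStep (k + 1) 1 (normalFormStep (k + 1) 0 p) = _
    simp only [normalFormStep, Nat.add_sub_cancel, Prod.mk.injEq, true_and]
    ring
  have hvw : BnCon n v w := (BnCon n).eq.1 h
  have hact : wordAction n v = wordAction n w := hle hvw
  exact congrFun hact (0, 0)

lemma wordNormalForm_one (n : ℕ) : wordNormalForm n 1 = (0, 0) := by
  rw [wordNormalForm, map_one]
  rfl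

lemma wordNormalForm_length (n : ℕ) (w : FreeMonoid (Fin 2)) :
    ((wordNormalForm n w).2 = 0 ∧ w.length = (wordNormalForm n w).1) ∨
      ∃ t r, (wordNormalForm n w).2 = 1 + t + r * (n - 1) ∧
        w.length = (wordNormalForm n w).1 + 1 + t + r := by
  induction w using FreeMonoid.inductionOn' with
  | one => left; simp [wordNormalForm_one]
  | of_mul x w ih =>
    have hstep : wordNormalForm n (FreeMonoid.of x * w)
        = normalFormStep n x (wordNormalForm n w) := by
      rw [wordNormalForm, map_mul, wordAction, FreeMonoid.lift_eval_of]
      rfl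
    rw [hstep, FreeMonoid.length_mul, FreeMonoid.length_of]
    fin_cases x
    · rcases ih with ⟨h₁, h₂⟩ | ⟨t, r, h₁, h₂⟩
      · left
        simp only [normalFormStep]
        omega
      · right
        refine ⟨t, r, h₁, ?_⟩
        simp only [normalFormStep]
        omega
    · right
      rcases ih with ⟨h₁, h₂⟩ | ⟨t, r, h₁, h₂⟩
      · refine ⟨0, w.length, ?_, ?_⟩
        · simp [normalFormStep, h₁, h₂]
        · simp [normalFormStep]
      · refine ⟨t + 1, r + (wordNormalForm n w).1, ?_, ?_⟩
        · simp only [normalFormStep, h₁]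
          ring
        · simp only [normalFormStep, h₂]
          ring

lemma length_eq_zero_of_mk'_eq_one {n : ℕ} (hn : 1 ≤ n) {w : FreeMonoid (Fin 2)}
    (h : (BnCon n).mk' w = 1) : w.length = 0 := by
  have h0 := wordNormalForm_eq_of_mk'_eq hn (h.trans (map_one (BnCon n).mk').symm)
  rw [wordNormalForm_one] at h0
  rcases wordNormalForm_length n w with ⟨-, h₂⟩ | ⟨t, r, h₁, -⟩
  · rw [h₂, h0]
  · rw [h0] at h₁
    simp only at h₁
    omega

lemma length_eq_one_of_mk'_eq_of {n : ℕ} (hn : 2 ≤ n) {w : FreeMonoid (Fin 2)} {x : Fin 2}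
    (h : (BnCon n).mk' w = (BnCon n).mk' (FreeMonoid.of x)) : w.length = 1 := by
  have h0 := wordNormalForm_eq_of_mk'_eq (by omega) h
  have h1 : wordNormalForm n (FreeMonoid.of x) = normalFormStep n x (0, 0) := by
    simp [wordNormalForm, wordAction]
  rw [h1] at h0
  have key := wordNormalForm_length n w
  rw [h0] at key
  fin_cases x <;> simp only [normalFormStep] at key
  · rcases key with ⟨-, h₂⟩ | ⟨t, r, h₁, -⟩
    · exact h₂
    · omega
  · rcases key with ⟨h₁, -⟩ | ⟨t, r, h₁, h₂⟩
    · omega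
    · have : r = 0 := by
        by_contra hr
        have := Nat.mul_le_mul (Nat.one_le_iff_ne_zero.2 hr) (show 1 ≤ n - 1 by omega)
        omega
      subst this
      omega

lemma Bn.eq_one_of_isUnit {n : ℕ} (hn : 1 ≤ n) {u : Bn n} (hu : IsUnit u) : u = 1 := by
  obtain ⟨v, huv⟩ := hu.exists_right_inv
  obtain ⟨u, rfl⟩ := (BnCon n).mk'_surjective u
  obtain ⟨v, rfl⟩ := (BnCon n).mk'_surjective v
  rw [← map_mul] at huv
  have h := length_eq_zero_of_mk'_eq_one hn huv
  rw [FreeMonoid.length_mul] at h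
  rw [FreeMonoid.length_eq_zero.1 (by omega : u.length = 0), map_one]

lemma Bn.isMonAtom_iff {n : ℕ} (hn : 2 ≤ n) (u : Bn n) :
    IsMonAtom u ↔ ∃ x, u = (BnCon n).mk' (FreeMonoid.of x) := by
  constructor
  · rintro ⟨hu, h⟩
    obtain ⟨w, rfl⟩ := (BnCon n).mk'_surjective u
    induction w using FreeMonoid.casesOn with
    | one => exact absurd (by rw [map_one]; exact isUnit_one) hu
    | of_mul x w =>
      refine ⟨x, ?_⟩
      rcases h _ _ (map_mul _ _ _) with hx | hw
      · have := length_eq_zero_of_mk'_eq_one (by omega) (Bn.eq_one_of_isUnit (by omega) hx)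
        simp at this
      · rw [map_mul, Bn.eq_one_of_isUnit (by omega) hw, mul_one]
  · rintro ⟨x, rfl⟩
    refine ⟨fun hx => ?_, fun c d hcd => ?_⟩
    · have := length_eq_zero_of_mk'_eq_one (by omega) (Bn.eq_one_of_isUnit (by omega) hx)
      simp at this
    · obtain ⟨c, rfl⟩ := (BnCon n).mk'_surjective c
      obtain ⟨d, rfl⟩ := (BnCon n).mk'_surjective d
      rw [← map_mul] at hcd
      have h := length_eq_one_of_mk'_eq_of hn hcd.symm
      rw [FreeMonoid.length_mul] at h
      rcases (by omega : c.length = 0 ∨ d.length = 0) with h | h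
      · left
        rw [FreeMonoid.length_eq_zero.1 h, map_one]
        exact isUnit_one
      · right
        rw [FreeMonoid.length_eq_zero.1 h, map_one]
        exact isUnit_one

lemma Bn.mem_setOfLengths_iff {n : ℕ} (hn : 2 ≤ n) (x : Bn n) (k : ℕ) :
    k ∈ setOfLengths x ↔ ∃ w : FreeMonoid (Fin 2), w.length = k ∧ (BnCon n).mk' w = x := by
  unfold setOfLengths
  split_ifs with hx
  · subst hx
    constructor
    · rintro rfl
      exact ⟨1, by simp, map_one _⟩
    · rintro ⟨w, rfl, hw⟩
      exact length_eq_zero_of_mk'_eq_one (by omega) hw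
  · constructor
    · rintro ⟨l, rfl, hl, rfl⟩
      clear hx
      induction l with
      | nil => exact ⟨1, by simp, map_one _⟩
      | cons u l ih =>
        obtain ⟨w, hw, hwl⟩ := ih fun v hv => hl v (List.mem_cons_of_mem _ hv)
        obtain ⟨x, rfl⟩ := (Bn.isMonAtom_iff hn u).1 (hl u List.mem_cons_self)
        refine ⟨FreeMonoid.of x * w, ?_, ?_⟩
        · rw [FreeMonoid.length_mul, FreeMonoid.length_of, hw, List.length_cons, add_comm]
        · rw [map_mul, hwl, List.prod_cons]
    · rintro ⟨w, rfl, rfl⟩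
      refine ⟨w.toList.map fun x => (BnCon n).mk' (FreeMonoid.of x), ?_, ?_, ?_⟩
      · rw [List.length_map]; rfl
      · intro u hu
        obtain ⟨x, -, rfl⟩ := List.mem_map.1 hu
        exact (Bn.isMonAtom_iff hn _).2 ⟨x, rfl⟩
      · clear hx
        induction w using FreeMonoid.inductionOn' with
        | one => simp
        | of_mul x w ih => rw [map_mul (BnCon n).mk', ← ih]; rfl

lemma bB_mul_bA_pow {n : ℕ} (hn : 1 ≤ n) (p : ℕ) :
    bB n * bA n ^ p = bB n ^ (1 + p * (n - 1)) := by
  have hba : bB n * bA n = bB n ^ n := by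
    have h : BnCon n (FreeMonoid.of 1 * FreeMonoid.of 0) (FreeMonoid.of 1 ^ n) :=
      ConGen.Rel.of _ _ ⟨rfl, rfl⟩
    exact (BnCon n).eq.2 h
  induction p with
  | zero => simp
  | succ p ih =>
    rw [pow_succ, ← mul_assoc, ih, add_comm 1, pow_succ, mul_assoc, hba, ← pow_add]
    congr 1
    rw [add_mul, one_mul]
    omega

lemma Bn.lengths_bB_pow {n : ℕ} (hn : 2 ≤ n) (p t : ℕ) :
    1 + p + t ∈ setOfLengths (bB n ^ (1 + p * (n - 1) + t)) := by
  refine (Bn.mem_setOfLengths_iff hn _ _).2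
    ⟨FreeMonoid.of 1 * FreeMonoid.of 0 ^ p * FreeMonoid.of 1 ^ t, ?_, ?_⟩
  · have hpow : ∀ (x : Fin 2) (k : ℕ), (FreeMonoid.of x ^ k).length = k := by
      intro x k
      induction k with
      | zero => simp
      | succ k ih => rw [pow_succ, FreeMonoid.length_mul, ih, FreeMonoid.length_of]
    simp [hpow]
  · rw [pow_add (bB n), ← bB_mul_bA_pow (by omega)]
    simp only [map_mul, map_pow]
    rfl

lemma Bn.mem_unionOfLengths_iff {n k ℓ : ℕ} :
    k ∈ unionOfLengths (Bn n) ℓ ↔ ∃ x : Bn n, ℓ ∈ setOfLengths x ∧ k ∈ setOfLengths x := by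
  simp [unionOfLengths, LSystem]

lemma qOf_eq {m : ℕ} (n : ℕ) (hm : 1 ≤ m) : qOf m n = (m - 1) / (n - 1) := by
  obtain ⟨m, rfl⟩ : ∃ k, m = k + 1 := ⟨m - 1, by omega⟩
  rw [qOf, if_neg (by omega), Nat.succ_div, Nat.add_sub_cancel]
  split_ifs <;> simp

/-- For `n ≥ 3` and `ℓ ≥ 2`, the union of sets of lengths of
`B_n` containing `ℓ` is `U_ℓ(B_n) = (ℓ − q_{ℓ,n}(n−2)) + (n−2)·[0, q_{ℓ,n} + ℓ − 1]`. -/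
theorem statement6 (n : ℕ) (hn : 3 ≤ n) (ℓ : ℕ) (hℓ : 2 ≤ ℓ) :
    unionOfLengths (Bn n) ℓ
      = apSet (ℓ - qOf ℓ n * (n - 2)) (n - 2) (qOf ℓ n + ℓ - 1) := by
  obtain ⟨m, rfl⟩ : ∃ m, n = m + 2 := ⟨n - 2, by omega⟩
  obtain ⟨e, rfl⟩ : ∃ e, ℓ = e + 1 := ⟨ℓ - 1, by omega⟩
  rw [qOf_eq _ (by omega)]
  simp only [Nat.add_sub_cancel, show m + 2 - 1 = m + 1 by omega]
  obtain ⟨q, hq⟩ : ∃ q, q = e / (m + 1) := ⟨_, rfl⟩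
  rw [← hq]
  have hqe : q * (m + 1) ≤ e := hq ▸ Nat.div_mul_le_self e (m + 1)
  rw [mul_add, mul_one] at hqe
  ext k
  rw [Bn.mem_unionOfLengths_iff]
  simp only [apSet, Set.mem_ofPred_eq]
  constructor
  · rintro ⟨x, hl, hk⟩
    obtain ⟨v, hv, hvx⟩ := (Bn.mem_setOfLengths_iff (by omega) _ _).1 hl
    obtain ⟨w, hw, hwx⟩ := (Bn.mem_setOfLengths_iff (by omega) _ _).1 hk
    have hvl := wordNormalForm_length (m + 2) v
    have hwl := wordNormalForm_length (m + 2) w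
    rw [wordNormalForm_eq_of_mk'_eq (by omega) (hvx.trans hwx.symm)] at hvl
    simp only [show m + 2 - 1 = m + 1 by omega] at hvl hwl
    rcases hvl with ⟨h₁, h₂⟩ | ⟨t, r, h₁, h₂⟩ <;>
      rcases hwl with ⟨h₃, h₄⟩ | ⟨t', r', h₃, h₄⟩
    · refine ⟨q, by omega, ?_⟩
      rw [mul_comm m q]
      omega
    · omega
    · omega
    · have hrq : r' ≤ q + r := by
        rw [← Nat.sub_le_iff_le_add, hq, Nat.le_div_iff_mul_le (by omega), Nat.sub_mul]
        omega
      refine ⟨q + r - r', by omega, ?_⟩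
      zify [hrq, (by omega : q * m ≤ e + 1)]
      zify at h₁ h₂ h₃ h₄ hv hw
      linear_combination h₄ - h₂ - hw + hv - h₃ + h₁
  · rintro ⟨j, hj, rfl⟩
    rw [show m * j = j * m from mul_comm m j]
    rcases le_total q j with h | h
    · obtain ⟨s, rfl⟩ := Nat.exists_eq_add_of_le h
      have h₁ := Bn.lengths_bB_pow (n := m + 2) (by omega) s (e - s)
      have h₂ := Bn.lengths_bB_pow (n := m + 2) (by omega) 0 (s * (m + 1) + (e - s))
      simp only [show m + 2 - 1 = m + 1 by omega] at h₁ h₂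
      rw [show 1 + s + (e - s) = e + 1 by omega] at h₁
      rw [show 1 + 0 * (m + 1) + (s * (m + 1) + (e - s)) = 1 + s * (m + 1) + (e - s) by ring,
        show 1 + 0 + (s * (m + 1) + (e - s)) = e + 1 - q * m + (q + s) * m by
          rw [mul_add, mul_one, add_mul]; omega] at h₂
      exact ⟨_, h₁, h₂⟩
    · obtain ⟨p, rfl⟩ := Nat.exists_eq_add_of_le h
      rw [add_mul] at hqe
      have hpe : p * (m + 1) ≤ e := by rw [mul_add, mul_one]; omega
      have h₁ := Bn.lengths_bB_pow (n := m + 2) (by omega) p (e - p * (m + 1))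
      have h₂ := Bn.lengths_bB_pow (n := m + 2) (by omega) 0 e
      simp only [show m + 2 - 1 = m + 1 by omega] at h₁ h₂
      rw [show 1 + p * (m + 1) + (e - p * (m + 1)) = 1 + 0 * (m + 1) + e by omega,
        show 1 + p + (e - p * (m + 1)) = e + 1 - (j + p) * m + j * m by
          rw [mul_add, mul_one] at hpe ⊢
          rw [add_mul]
          omega] at h₁
      rw [show 1 + 0 + e = e + 1 by omega] at h₂
      exact ⟨_, h₂, h₁⟩
end
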